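/- The single-clause Lindbladians attached to distinct ancilla qubits commute: for all j, k ∈ Fin N, ℒⱼ ∘ ℒₖ = ℒₖ ∘ ℒⱼ as linear endomorphisms of the matrix space. -/

import Mathlib

open Matrix Filter
open scoped Kronecker Topology

attribute [local instance] Matrix.normedAddCommGroup Matrix.normedSpace

noncomputable section

/-- The computational basis of `n` qubits, `X = {0,1}ⁿ`. -/
abbrev QubitBasis (n : ℕ) := Fin n → Bool

/-- Evaluation of the 3-literal clause with indices `i₁ i₂ i₃` and bits `b₁ b₂ b₃`:
`C(x) = ¬(x i₁ = b₁ ∧ x i₂ = b₂ ∧ x i₃ = b₃)`. -/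
def clauseEval {n : ℕ} (i₁ i₂ i₃ : Fin n) (b₁ b₂ b₃ : Bool) (x : QubitBasis n) : Bool :=
  ! (decide (x i₁ = b₁) && decide (x i₂ = b₂) && decide (x i₃ = b₃))

/-- The Lindblad operator `Lⱼ` attached to the `j`-th clause of an `N`-clause network:
`Lⱼ((x,ā),(y,b̄)) = 1` iff `x = y`, `Cⱼ(x) = false`, `ā j = false`, `b̄ j = true`, and
`ā k = b̄ k` for all `k ≠ j`. -/
def jumpOpN {n N : ℕ} (C : Fin N → QubitBasis n → Bool) (j : Fin N) :
    Matrix (QubitBasis n × (Fin N → Bool)) (QubitBasis n × (Fin N → Bool)) ℂ :=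
  Matrix.of fun p q =>
    if p.1 = q.1 ∧ C j p.1 = false ∧ p.2 j = false ∧ q.2 j = true ∧
        (∀ k, k ≠ j → p.2 k = q.2 k) then 1 else 0

/-- The Lindbladian `ℒ(ρ) = γ (L ρ L† − (1/2)(L†L ρ + ρ L†L))` as a linear endomorphism
of the matrix space. -/
def lindbladian {d : Type*} [Fintype d] [DecidableEq d] (γ : ℝ) (L : Matrix d d ℂ) :
    Matrix d d ℂ →ₗ[ℂ] Matrix d d ℂ :=
  (γ : ℂ) • ((LinearMap.mulRight ℂ Lᴴ).comp (LinearMap.mulLeft ℂ L)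
    - (1 / 2 : ℂ) • (LinearMap.mulLeft ℂ (Lᴴ * L) + LinearMap.mulRight ℂ (Lᴴ * L)))

/-- The evolution `E_t = exp(t·ℒ)`, the exponential of the endomorphism `ℒ`. -/
def evol {d : Type*} [Fintype d] [DecidableEq d]
    (L : Matrix d d ℂ →ₗ[ℂ] Matrix d d ℂ) (t : ℝ) :
    Matrix d d ℂ →L[ℂ] Matrix d d ℂ :=
  haveI : IsTopologicalRing (Matrix d d ℂ →L[ℂ] Matrix d d ℂ) :=
    (fun (E : Type _) (_ : NormedAddCommGroup E) (_ : NormedSpace ℂ E) =>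
      (inferInstance : IsTopologicalRing (E →L[ℂ] E)))
      (Matrix d d ℂ) Matrix.normedAddCommGroup Matrix.normedSpace
  NormedSpace.exp ((t : ℂ) • LinearMap.toContinuousLinearMap L)

theorem jumpOpN_mul {n N : ℕ} (C : Fin N → QubitBasis n → Bool) (j : Fin N)
    (M : Matrix (QubitBasis n × (Fin N → Bool)) (QubitBasis n × (Fin N → Bool)) ℂ)
    (p q : QubitBasis n × (Fin N → Bool)) :
    (jumpOpN C j * M) p q = if C j p.1 = false ∧ p.2 j = false then
      M (p.1, Function.update p.2 j true) q else 0 := by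
  have key : ∀ r : QubitBasis n × (Fin N → Bool), jumpOpN C j p r =
      if r = (p.1, Function.update p.2 j true) then
        (if C j p.1 = false ∧ p.2 j = false then 1 else 0) else 0 := by
    rintro ⟨x, a⟩
    have : (x, a) = (p.1, Function.update p.2 j true) ↔
        p.1 = x ∧ a j = true ∧ ∀ k, k ≠ j → p.2 k = a k := by
      rw [Prod.mk.injEq, Function.eq_update_iff]
      constructor
      · rintro ⟨h, h1, h2⟩
        exact ⟨h.symm, h1, fun k hk => (h2 k hk).symm⟩
      · rintro ⟨h, h1, h2⟩
        exact ⟨h.symm, h1, fun k hk => (h2 k hk).symm⟩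
    rw [← ite_and]
    simp only [jumpOpN, Matrix.of_apply, this]
    congr 1
    apply propext
    tauto
  rw [Matrix.mul_apply]
  simp only [key, ite_mul, zero_mul, one_mul, Finset.sum_ite_eq', Finset.mem_univ, if_true]

theorem jumpOpN_conjTranspose_mul {n N : ℕ} (C : Fin N → QubitBasis n → Bool) (j : Fin N)
    (M : Matrix (QubitBasis n × (Fin N → Bool)) (QubitBasis n × (Fin N → Bool)) ℂ)
    (p q : QubitBasis n × (Fin N → Bool)) :
    ((jumpOpN C j)ᴴ * M) p q = if C j p.1 = false ∧ p.2 j = true then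
      M (p.1, Function.update p.2 j false) q else 0 := by
  have key : ∀ r : QubitBasis n × (Fin N → Bool), (jumpOpN C j)ᴴ p r =
      if r = (p.1, Function.update p.2 j false) then
        (if C j p.1 = false ∧ p.2 j = true then 1 else 0) else 0 := by
    rintro ⟨x, a⟩
    have : (x, a) = (p.1, Function.update p.2 j false) ↔
        x = p.1 ∧ a j = false ∧ ∀ k, k ≠ j → a k = p.2 k := by
      rw [Prod.mk.injEq, Function.eq_update_iff]
    rw [← ite_and]
    simp only [jumpOpN, Matrix.conjTranspose_apply, Matrix.of_apply, this, apply_ite star,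
      star_one, star_zero]
    congr 1
    apply propext
    constructor
    · rintro ⟨rfl, h⟩
      tauto
    · rintro ⟨⟨rfl, h⟩, h'⟩
      tauto
  rw [Matrix.mul_apply]
  simp only [key, ite_mul, zero_mul, one_mul]
  rw [Finset.sum_ite_eq']
  simp

theorem jumpOpN_comm {n N : ℕ} (C : Fin N → QubitBasis n → Bool) {j k : Fin N} (h : j ≠ k) :
    jumpOpN C j * jumpOpN C k = jumpOpN C k * jumpOpN C j := by
  rw [← mul_one (jumpOpN C j * _), ← mul_one (jumpOpN C k * _), mul_assoc, mul_assoc]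
  ext p q
  simp only [jumpOpN_mul, Function.update_of_ne h, Function.update_of_ne h.symm,
    ← ite_and]
  congr 1
  · apply propext
    tauto
  · rw [Function.update_comm h]

theorem jumpOpN_comm_conj {n N : ℕ} (C : Fin N → QubitBasis n → Bool) {j k : Fin N}
    (h : j ≠ k) :
    jumpOpN C j * (jumpOpN C k)ᴴ = (jumpOpN C k)ᴴ * jumpOpN C j := by
  rw [← mul_one (jumpOpN C j * _), ← mul_one ((jumpOpN C k)ᴴ * _), mul_assoc, mul_assoc]
  ext p q
  simp only [jumpOpN_mul, jumpOpN_conjTranspose_mul, Function.update_of_ne h,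
    Function.update_of_ne h.symm, ← ite_and]
  congr 1
  · apply propext
    tauto
  · rw [Function.update_comm h]

theorem lindbladian_comm {d : Type*} [Fintype d] [DecidableEq d] (γ : ℝ) (A B : Matrix d d ℂ)
    (h : Commute A B) (h' : Commute A Bᴴ) :
    Commute (lindbladian γ A) (lindbladian γ B) := by
  have h1 : Commute Aᴴ Bᴴ := by
    have := congrArg Matrix.conjTranspose h.eq
    simp only [Matrix.conjTranspose_mul] at this
    exact this.symm
  have h2 : Commute Aᴴ B := by
    have := congrArg Matrix.conjTranspose h'.eq
    simp only [Matrix.conjTranspose_mul, Matrix.conjTranspose_conjTranspose] at this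
    exact this.symm
  have hl : ∀ {P Q : Matrix d d ℂ}, Commute P Q →
      Commute (LinearMap.mulLeft ℂ P) (LinearMap.mulLeft ℂ Q) := by
    intro P Q hc
    refine LinearMap.ext fun M => ?_
    simp [← mul_assoc, hc.eq]
  have hr : ∀ {P Q : Matrix d d ℂ}, Commute P Q →
      Commute (LinearMap.mulRight ℂ P) (LinearMap.mulRight ℂ Q) := by
    intro P Q hc
    refine LinearMap.ext fun M => ?_
    simp [mul_assoc, hc.eq]
  have hlr : ∀ (P Q : Matrix d d ℂ),
      Commute (LinearMap.mulLeft ℂ P) (LinearMap.mulRight ℂ Q) := by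
    intro P Q
    refine LinearMap.ext fun M => ?_
    simp [mul_assoc]
  have hAN : Commute A (Bᴴ * B) := h'.mul_right h
  have hAN' : Commute Aᴴ (Bᴴ * B) := h1.mul_right h2
  have hNB : Commute (Aᴴ * A) B := h2.mul_left h
  have hNB' : Commute (Aᴴ * A) Bᴴ := h1.mul_left h'
  have hNN : Commute (Aᴴ * A) (Bᴴ * B) := hAN'.mul_left hAN
  unfold lindbladian
  simp only [← Module.End.mul_eq_comp]
  refine Commute.smul_left (Commute.smul_right ?_ _) _
  refine Commute.sub_left (Commute.sub_right ?_ (Commute.smul_right ?_ _))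
    (Commute.smul_left (Commute.sub_right ?_ (Commute.smul_right ?_ _)) _)
  · exact ((hr h1).mul_right (hlr _ _).symm).mul_left ((hlr _ _).mul_right (hl h))
  · exact (((hlr _ _).symm.add_right (hr hAN'))).mul_left ((hl hAN).add_right (hlr _ _))
  · exact ((hlr _ _).mul_right (hl hNB)).add_left ((hr hNB').mul_right (hlr _ _).symm)
  · exact ((hl hNN).add_right (hlr _ _)).add_left ((hlr _ _).symm.add_right (hr hNN))

/-- the single-clause Lindbladians attached to distinct ancilla qubits
commute as linear endomorphisms. -/
theorem lindbladians_commute {n N : ℕ} (hn : 1 ≤ n) (hN : 1 ≤ N)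
    (i₁ i₂ i₃ : Fin N → Fin n)
    (h₁₂ : ∀ j, i₁ j ≠ i₂ j) (h₁₃ : ∀ j, i₁ j ≠ i₃ j) (h₂₃ : ∀ j, i₂ j ≠ i₃ j)
    (b₁ b₂ b₃ : Fin N → Bool) (γ : ℝ) (hγ : 0 < γ)
    (C : Fin N → QubitBasis n → Bool)
    (hC : ∀ j, C j = clauseEval (i₁ j) (i₂ j) (i₃ j) (b₁ j) (b₂ j) (b₃ j))
    (j k : Fin N) :
    (lindbladian γ (jumpOpN C j)).comp (lindbladian γ (jumpOpN C k))
      = (lindbladian γ (jumpOpN C k)).comp (lindbladian γ (jumpOpN C j)) := by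
  by_cases h : j = k
  · rw [h]
  · exact (lindbladian_comm γ _ _ (jumpOpN_comm C h) (jumpOpN_comm_conj C h)).eq
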